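/- arXiv:math/0404300 — 3 statements merged into one kernel-verified Lean document; each statement's English description precedes it below -/
import Mathlib

section
/- For every n ∈ ℙ, ∑_{β ∈ B_n} q^{fmaj(β)} = ∑_{β ∈ B_n} q^{ℓ_B(β)}, i.e., the flag-major index is equidistributed with the Coxeter length on the hyperoctahedral group. -/
open Finset Polynomial

/-- The hyperoctahedral group `B n`, modeled as pairs (permutation, sign vector):
the signed permutation with window `β(i) = ±(σ(i)+1)`. -/
abbrev Bgrp (n : ℕ) := Equiv.Perm (Fin n) × (Fin n → Bool)

/-- The window entry `β(i)` (a nonzero integer). -/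
def wdw {n : ℕ} (β : Bgrp n) (i : Fin n) : ℤ :=
  (if β.2 i then -1 else 1) * ((β.1 i : ℤ) + 1)

/-- Window entry at a `ℕ` position (0-based), `0` out of range. -/
def wdwN {n : ℕ} (β : Bgrp n) (i : ℕ) : ℤ :=
  if h : i < n then wdw β ⟨i, h⟩ else 0

/-- Number of inversions of the window. -/
def invB {n : ℕ} (β : Bgrp n) : ℕ :=
  ((univ : Finset (Fin n × Fin n)).filter
    (fun p => p.1 < p.2 ∧ wdw β p.2 < wdw β p.1)).card

/-- The set of positions with negative entries. -/
def NegB {n : ℕ} (β : Bgrp n) : Finset (Fin n) :=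
  univ.filter (fun i => wdw β i < 0)

def N1 {n : ℕ} (β : Bgrp n) : ℕ := (NegB β).card

def N2 {n : ℕ} (β : Bgrp n) : ℕ :=
  ((univ : Finset (Fin n × Fin n)).filter
    (fun p => p.1 < p.2 ∧ wdw β p.1 + wdw β p.2 < 0)).card

/-- The order `-1 ≺ -2 ≺ ⋯ ≺ -n ≺ 1 ≺ 2 ≺ ⋯ ≺ n` on nonzero integers. -/
def precLt (a b : ℤ) : Prop :=
  (a < 0 ∧ b < 0 ∧ b < a) ∨ (a < 0 ∧ 0 < b) ∨ (0 < a ∧ 0 < b ∧ a < b)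

instance (a b : ℤ) : Decidable (precLt a b) := by unfold precLt; infer_instance

/-- Descent set of the window, with respect to `≺` (0-based positions). -/
def DesB {n : ℕ} (β : Bgrp n) : Finset ℕ :=
  (range (n-1)).filter (fun i => precLt (wdwN β (i+1)) (wdwN β i))

/-- Major index: sum of the (1-based) descent positions. -/
def majB {n : ℕ} (β : Bgrp n) : ℕ := ∑ i ∈ DesB β, (i+1)

/-- Flag-major index. -/
def fmaj {n : ℕ} (β : Bgrp n) : ℕ := 2 * majB β + N1 β

/-- Group multiplication (composition of signed permutations). -/
def bmul {n : ℕ} (β γ : Bgrp n) : Bgrp n :=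
  (β.1 * γ.1, fun i => xor (γ.2 i) (β.2 (γ.1 i)))

/-- The identity signed permutation. -/
def bone (n : ℕ) : Bgrp n := (1, fun _ => false)

/-- The Coxeter generators `s_0, s_1, …, s_{n-1}` of `B n`. -/
def BGens (n : ℕ) : Set (Bgrp n) :=
  { b | (∃ h : 0 < n, b = ((1 : Equiv.Perm (Fin n)), fun j => decide (j = (⟨0, h⟩ : Fin n)))) ∨
        (∃ (i : ℕ) (h : i + 1 < n),
          b = (Equiv.swap ⟨i, Nat.lt_of_succ_lt h⟩ ⟨i+1, h⟩, fun _ => false)) }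

/-- Minimal length of an expression of `β` as a product of the generators of `B n`. -/
noncomputable def lenB {n : ℕ} (β : Bgrp n) : ℕ :=
  sInf {k | ∃ l : List (Bgrp n), l.length = k ∧ (∀ g ∈ l, g ∈ BGens n) ∧
    l.foldr bmul (bone n) = β}

/-- The Coxeter generators `s_0^D, s_1, …, s_{n-1}` of `D n`. -/
def DGens (n : ℕ) : Set (Bgrp n) :=
  { b | (∃ h : 1 < n,
          b = (Equiv.swap ⟨0, Nat.lt_of_succ_lt h⟩ ⟨1, h⟩, fun (j : Fin n) => decide ((j : ℕ) < 2))) ∨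
        (∃ (i : ℕ) (h : i + 1 < n),
          b = (Equiv.swap ⟨i, Nat.lt_of_succ_lt h⟩ ⟨i+1, h⟩, fun _ => false)) }

/-- Minimal length of an expression as a product of the generators of `D n`. -/
noncomputable def lenD {n : ℕ} (β : Bgrp n) : ℕ :=
  sInf {k | ∃ l : List (Bgrp n), l.length = k ∧ (∀ g ∈ l, g ∈ DGens n) ∧
    l.foldr bmul (bone n) = β}

/-- The even-signed permutation group `D n` as a finset of `B n`. -/
def Dgrp (n : ℕ) : Finset (Bgrp n) := univ.filter (fun γ => Even (N1 γ))

/-- `Δ_n = {γ ∈ B_n : γ(n) > 0}`. -/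
def DeltaSet (n : ℕ) : Finset (Bgrp n) := univ.filter (fun γ => 0 < wdwN γ (n-1))

/-- `|γ|_n`: replace the last window entry by its absolute value. -/
def absLast {n : ℕ} (γ : Bgrp n) : Bgrp n :=
  (γ.1, fun i => if (i : ℕ) = n - 1 then false else γ.2 i)

/-- The `D`-major index. -/
def Dmaj {n : ℕ} (γ : Bgrp n) : ℕ := fmaj (absLast γ)

/-- `-β`: negate all window entries. -/
def negB {n : ℕ} (β : Bgrp n) : Bgrp n := (β.1, fun i => !β.2 i)

/-- Number of inversions of a permutation of `Fin n`. -/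
def invS {n : ℕ} (σ : Equiv.Perm (Fin n)) : ℕ :=
  ((univ : Finset (Fin n × Fin n)).filter
    (fun p => p.1 < p.2 ∧ σ p.2 < σ p.1)).card

/-- Major index of a permutation of `Fin n` (usual order). -/
def majS {n : ℕ} (σ : Equiv.Perm (Fin n)) : ℕ :=
  ∑ i ∈ (range (n-1)).filter
      (fun i => ∀ h : i + 1 < n, σ ⟨i+1, h⟩ < σ ⟨i, Nat.lt_of_succ_lt h⟩), (i+1)

/-- The `q`-analogue `[m]_q = 1 + q + ⋯ + q^{m-1}`, evaluated at a polynomial `q`. -/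
noncomputable def qpoly (m : ℕ) (q : Polynomial ℤ) : Polynomial ℤ := ∑ k ∈ range m, q ^ k

namespace Hyperoctahedral

/-- The permutation of `Fin (n + 1)` with last value `a` and whose first `n` values are in the
same relative order as those of `σ`. -/
def permSnoc {n : ℕ} (a : Fin (n + 1)) (σ : Equiv.Perm (Fin n)) : Equiv.Perm (Fin (n + 1)) :=
  ((finSuccEquiv' (Fin.last n)).trans σ.optionCongr).trans (finSuccEquiv' a).symm

lemma permSnoc_last {n : ℕ} (a : Fin (n + 1)) (σ : Equiv.Perm (Fin n)) :
    permSnoc a σ (Fin.last n) = a := by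
  simp [permSnoc]

lemma permSnoc_castSucc {n : ℕ} (a : Fin (n + 1)) (σ : Equiv.Perm (Fin n)) (i : Fin n) :
    permSnoc a σ i.castSucc = a.succAbove (σ i) := by
  rw [← Fin.succAbove_last_apply]
  simp [permSnoc, -Fin.succAbove_last]

/-- The signed permutation obtained from `β` by appending a last entry of absolute value `a`
and sign `s`, standardizing the absolute values of the other entries. -/
def snoc {n : ℕ} (x : (Fin (n + 1) × Bool) × Bgrp n) : Bgrp (n + 1) :=
  (permSnoc x.1.1 x.2.1, Fin.snoc (α := fun _ => Bool) x.2.2 x.1.2)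

lemma snoc_injective {n : ℕ} : Function.Injective (snoc (n := n)) := by
  rintro ⟨⟨a, s⟩, σ, ε⟩ ⟨⟨a', s'⟩, σ', ε'⟩ h
  simp only [snoc, Prod.mk.injEq] at h
  obtain ⟨h₁, h₂⟩ := h
  have ha : a = a' := by simpa only [permSnoc_last] using DFunLike.congr_fun h₁ (Fin.last n)
  subst ha
  have hσ : σ = σ' := by
    ext1 i
    have := DFunLike.congr_fun h₁ i.castSucc
    simpa only [permSnoc_castSucc, Fin.succAbove_right_inj] using this
  have hs : s = s' := by simpa using congr_fun h₂ (Fin.last n)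
  have hε : ε = ε' := by
    funext i
    simpa using congr_fun h₂ i.castSucc
  rw [hσ, hs, hε]

lemma snoc_bijective {n : ℕ} : Function.Bijective (snoc (n := n)) := by
  rw [Fintype.bijective_iff_injective_and_card]
  refine ⟨snoc_injective, ?_⟩
  simp [Fintype.card_perm, Nat.factorial_succ]
  ring

lemma sum_eq_sum_snoc {n : ℕ} (f : Bgrp (n + 1) → Polynomial ℤ) :
    ∑ β, f β = ∑ p : Fin (n + 1) × Bool, ∑ β : Bgrp n, f (snoc (p, β)) := by
  rw [← Fintype.sum_prod_type' (f := fun p β => f (snoc (p, β)))]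
  exact (snoc_bijective.sum_comp f).symm

/-! ### The Coxeter length -/

/-- The number of entries before position `j` of smaller absolute value. -/
def smallerBefore {n : ℕ} (σ : Equiv.Perm (Fin n)) (j : Fin n) : ℕ :=
  #{i | i < j ∧ σ i < σ j}

/-- The contribution of position `j` to the combinatorial length. -/
def lenTerm {n : ℕ} (β : Bgrp n) (j : Fin n) : ℕ :=
  if β.2 j then j + 1 + smallerBefore β.1 j else j - smallerBefore β.1 j

/-- The combinatorial description of the Coxeter length. -/
def combLen {n : ℕ} (β : Bgrp n) : ℕ := ∑ j, lenTerm β j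

lemma smallerBefore_le {n : ℕ} (σ : Equiv.Perm (Fin n)) (j : Fin n) :
    smallerBefore σ j ≤ j := by
  calc smallerBefore σ j ≤ #(Iio j) := card_le_card fun i => by simp +contextual
    _ = j := by simp

lemma smallerBefore_permSnoc_last {n : ℕ} (a : Fin (n + 1)) (σ : Equiv.Perm (Fin n)) :
    smallerBefore (permSnoc a σ) (Fin.last n) = a := by
  have h : ({i | i < Fin.last n ∧ permSnoc a σ i < permSnoc a σ (Fin.last n)} :
      Finset (Fin (n + 1))) = (Iio a).map (permSnoc a σ).symm.toEmbedding := by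
    ext i
    simp only [mem_filter, mem_univ, true_and, permSnoc_last, mem_map_equiv, Equiv.symm_symm,
      mem_Iio, and_iff_right_iff_imp]
    intro hi
    refine lt_of_le_of_ne (Fin.le_last i) ?_
    rintro rfl
    simp [permSnoc_last] at hi
  rw [smallerBefore, h]
  simp

lemma smallerBefore_permSnoc_castSucc {n : ℕ} (a : Fin (n + 1)) (σ : Equiv.Perm (Fin n))
    (j : Fin n) : smallerBefore (permSnoc a σ) j.castSucc = smallerBefore σ j := by
  have h : ({i | i < j.castSucc ∧ permSnoc a σ i < permSnoc a σ j.castSucc} :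
      Finset (Fin (n + 1))) =
      ({i | i < j ∧ σ i < σ j} : Finset (Fin n)).map Fin.castSuccEmb := by
    ext i
    refine Fin.lastCases ?_ (fun i => ?_) i
    · simp [Fin.not_lt.2 (Fin.le_last _), (Fin.castSucc_lt_last _).ne]
    · simp [permSnoc_castSucc]
  rw [smallerBefore, h, card_map, smallerBefore]

lemma combLen_snoc {n : ℕ} (a : Fin (n + 1)) (s : Bool) (β : Bgrp n) :
    combLen (snoc ((a, s), β)) = combLen β + (if s then n + 1 + a else n - a) := by
  simp [combLen, Fin.sum_univ_castSucc, lenTerm, snoc, smallerBefore_permSnoc_last,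
    smallerBefore_permSnoc_castSucc]

lemma sum_pow_combLen_succ (n : ℕ) :
    ∑ β : Bgrp (n + 1), (X : Polynomial ℤ) ^ combLen β =
      (∑ k ∈ range (2 * (n + 1)), X ^ k) * ∑ β : Bgrp n, (X : Polynomial ℤ) ^ combLen β := by
  have h : ∑ k ∈ range (2 * (n + 1)), (X : Polynomial ℤ) ^ k =
      ∑ p : Fin (n + 1) × Bool, X ^ (if p.2 then n + 1 + (p.1 : ℕ) else n - p.1) := by
    rw [Fintype.sum_prod_type, two_mul, sum_range_add, ← sum_range_reflect]
    simp only [Fintype.sum_bool, sum_add_distrib, if_true, Bool.false_eq_true, if_false]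
    rw [add_comm, Fin.sum_univ_eq_sum_range (fun i => (X : Polynomial ℤ) ^ (n + 1 + i)),
      Fin.sum_univ_eq_sum_range (fun i => (X : Polynomial ℤ) ^ (n - i))]
    simp
  rw [sum_eq_sum_snoc, h, sum_mul]
  refine sum_congr rfl fun p _ => ?_
  rw [mul_sum]
  refine sum_congr rfl fun β _ => ?_
  rw [combLen_snoc, pow_add, mul_comm]

/-- The generator changing the sign of the value `1`. -/
def signGen {n : ℕ} (z : Fin n) : Bgrp n := (1, fun j => decide (j = z))

/-- The generator exchanging the values `k` and `l`. -/
def swapGen {n : ℕ} (k l : Fin n) : Bgrp n := (Equiv.swap k l, fun _ => false)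

lemma mem_BGens {n : ℕ} {g : Bgrp n} : g ∈ BGens n ↔
    (∃ z : Fin n, (z : ℕ) = 0 ∧ g = signGen z) ∨
      ∃ k l : Fin n, (l : ℕ) = k + 1 ∧ g = swapGen k l := by
  constructor
  · rintro (⟨h, rfl⟩ | ⟨i, h, rfl⟩)
    · exact Or.inl ⟨⟨0, h⟩, rfl, rfl⟩
    · exact Or.inr ⟨⟨i, _⟩, ⟨i + 1, h⟩, rfl, rfl⟩
  · rintro (⟨⟨z, hz⟩, rfl, rfl⟩ | ⟨⟨k, hk⟩, ⟨l, hl⟩, h, rfl⟩)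
    · exact Or.inl ⟨hz, rfl⟩
    · simp only at h
      subst h
      exact Or.inr ⟨k, hl, rfl⟩

lemma bmul_bmul_self {n : ℕ} {g : Bgrp n} (hg : g ∈ BGens n) (β : Bgrp n) :
    bmul g (bmul g β) = β := by
  rcases mem_BGens.1 hg with ⟨z, -, rfl⟩ | ⟨k, l, -, rfl⟩ <;>
    ext <;> simp [bmul, signGen, swapGen]

/-- Sums that differ only in one term. -/
lemma sum_add_eq_sum_add {ι : Type*} [Fintype ι] [DecidableEq ι] {f g : ι → ℕ} (m : ι)
    (h : ∀ j, j ≠ m → f j = g j) : ∑ j, f j + g m = ∑ j, g j + f m := by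
  rw [← add_sum_erase _ f (mem_univ m), ← add_sum_erase _ g (mem_univ m),
    sum_congr rfl fun j hj => h j (ne_of_mem_erase hj)]
  ring

lemma combLen_signGen {n : ℕ} {z : Fin n} (hz : (z : ℕ) = 0) (β : Bgrp n) :
    if β.2 (β.1.symm z) then combLen β = combLen (bmul (signGen z) β) + 1
    else combLen (bmul (signGen z) β) = combLen β + 1 := by
  have key := sum_add_eq_sum_add (f := lenTerm (bmul (signGen z) β)) (g := lenTerm β)
    (β.1.symm z) (fun j hj => by
      have : β.1 j ≠ z := fun h => hj (by simp [← h])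
      simp [lenTerm, bmul, signGen, this])
  have h0 : smallerBefore β.1 (β.1.symm z) = 0 := by
    refine card_eq_zero.2 (filter_eq_empty_iff.2 fun i _ h => ?_)
    have := Fin.lt_def.1 (Equiv.apply_symm_apply β.1 z ▸ h.2)
    omega
  change combLen _ + _ = combLen _ + _ at key
  generalize combLen (bmul (signGen z) β) = A at *
  generalize combLen β = B at *
  simp only [lenTerm, bmul, signGen, one_mul, h0, Equiv.apply_symm_apply, decide_true] at key
  split_ifs with h <;> simp [h] at key <;> omega

lemma swap_lt_swap_iff {n : ℕ} {k l a b : Fin n} (hkl : (l : ℕ) = k + 1)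
    (h₁ : ¬ (a = k ∧ b = l)) (h₂ : ¬ (a = l ∧ b = k)) :
    Equiv.swap k l a < Equiv.swap k l b ↔ a < b := by
  simp only [Equiv.swap_apply_def]
  split_ifs <;> grind

lemma smallerBefore_swap_of_ne {n : ℕ} {k l : Fin n} (hkl : (l : ℕ) = k + 1)
    (σ : Equiv.Perm (Fin n)) {j : Fin n} (hj : j ≠ max (σ.symm k) (σ.symm l)) :
    smallerBefore (Equiv.swap k l * σ) j = smallerBefore σ j := by
  unfold smallerBefore
  congr 1
  refine filter_congr fun i _ => and_congr_right fun hij => ?_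
  rw [Equiv.Perm.mul_apply, Equiv.Perm.mul_apply]
  apply swap_lt_swap_iff hkl
  · rintro ⟨rfl, rfl⟩
    simp [hij.le] at hj
  · rintro ⟨rfl, rfl⟩
    simp [hij.le] at hj

lemma smallerBefore_swap_max {n : ℕ} {k l : Fin n} (hkl : (l : ℕ) = k + 1)
    (σ : Equiv.Perm (Fin n)) (h : σ.symm k < σ.symm l) :
    smallerBefore σ (σ.symm l) = smallerBefore (Equiv.swap k l * σ) (σ.symm l) + 1 := by
  have hs : ({i | i < σ.symm l ∧ σ i < σ (σ.symm l)} : Finset (Fin n)) =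
      insert (σ.symm k) ({i | i < σ.symm l ∧ (Equiv.swap k l * σ) i <
        (Equiv.swap k l * σ) (σ.symm l)} : Finset (Fin n)) := by
    ext i
    simp only [mem_filter, mem_univ, true_and, mem_insert, Equiv.Perm.mul_apply,
      Equiv.apply_symm_apply]
    by_cases hi : i = σ.symm k
    · subst hi
      simp [h, Fin.lt_def, hkl]
    · have hk : σ i ≠ k := fun h => hi (by simp [← h])
      simp only [hi, false_or]
      refine and_congr_right fun _ => (swap_lt_swap_iff hkl (by simp [hk]) ?_).symm
      rintro ⟨-, h⟩
      simp [h] at hkl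
  rw [smallerBefore, hs, card_insert_of_notMem, smallerBefore]
  simp [Fin.le_def, hkl]

lemma smallerBefore_swap_max' {n : ℕ} {k l : Fin n} (hkl : (l : ℕ) = k + 1)
    (σ : Equiv.Perm (Fin n)) (h : σ.symm l < σ.symm k) :
    smallerBefore (Equiv.swap k l * σ) (σ.symm k) = smallerBefore σ (σ.symm k) + 1 := by
  have hsymm (x : Fin n) : (Equiv.swap k l * σ).symm x = σ.symm (Equiv.swap k l x) := by
    simp [Equiv.symm_apply_eq]
  have := smallerBefore_swap_max hkl (Equiv.swap k l * σ) (by simpa [hsymm] using h)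
  simpa [hsymm, ← mul_assoc] using this

lemma combLen_swapGen {n : ℕ} {k l : Fin n} (hkl : (l : ℕ) = k + 1) (β : Bgrp n) :
    if (β.1.symm k < β.1.symm l ↔ β.2 (max (β.1.symm k) (β.1.symm l)))
    then combLen β = combLen (bmul (swapGen k l) β) + 1
    else combLen (bmul (swapGen k l) β) = combLen β + 1 := by
  have key := sum_add_eq_sum_add (f := lenTerm (bmul (swapGen k l) β)) (g := lenTerm β)
    (max (β.1.symm k) (β.1.symm l)) (fun j hj => by
      simp [lenTerm, bmul, swapGen, smallerBefore_swap_of_ne hkl _ hj])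
  have hne : β.1.symm k ≠ β.1.symm l := by
    rw [Ne, β.1.symm.injective.eq_iff]
    rintro rfl
    simp at hkl
  have hle := smallerBefore_le β.1 (max (β.1.symm k) (β.1.symm l))
  have hle' := smallerBefore_le (Equiv.swap k l * β.1) (max (β.1.symm k) (β.1.symm l))
  change combLen _ + _ = combLen _ + _ at key
  generalize combLen (bmul (swapGen k l) β) = A at *
  generalize combLen β = B at *
  simp only [lenTerm, bmul, swapGen, Bool.xor_false] at key
  rcases lt_or_gt_of_ne hne with h | h
  · have := smallerBefore_swap_max hkl β.1 h
    rw [max_eq_right h.le] at *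
    simp only [h, true_iff]
    split_ifs at * <;> omega
  · have := smallerBefore_swap_max' hkl β.1 h
    rw [max_eq_left h.le] at *
    simp only [h.not_gt, false_iff]
    split_ifs at * <;> omega

lemma combLen_bmul_le {n : ℕ} {g : Bgrp n} (hg : g ∈ BGens n) (β : Bgrp n) :
    combLen (bmul g β) ≤ combLen β + 1 := by
  rcases mem_BGens.1 hg with ⟨z, hz, rfl⟩ | ⟨k, l, hkl, rfl⟩
  · have := combLen_signGen hz β
    split_ifs at this <;> omega
  · have := combLen_swapGen hkl β
    split_ifs at this <;> omega

lemma exists_combLen_bmul_lt {n : ℕ} {β : Bgrp n} (hβ : β ≠ bone n) :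
    ∃ g ∈ BGens n, combLen (bmul g β) < combLen β := by
  by_contra! H
  apply hβ
  have step (k l : Fin n) (hkl : (l : ℕ) = k + 1) (hk : β.2 (β.1.symm k) = false) :
      β.1.symm k < β.1.symm l ∧ β.2 (β.1.symm l) = false := by
    have h₁ := H _ (mem_BGens.2 (Or.inr ⟨k, l, hkl, rfl⟩))
    have h₂ := combLen_swapGen hkl β
    split_ifs at h₂ with h₃
    · omega
    rcases lt_or_ge (β.1.symm k) (β.1.symm l) with h | h
    · rw [max_eq_right h.le] at h₃
      simpa [h] using h₃
    · rw [max_eq_left h] at h₃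
      simp [h.not_gt, hk] at h₃
  have pos (m : ℕ) (hm : m < n) : β.2 (β.1.symm ⟨m, hm⟩) = false := by
    induction m with
    | zero =>
      have h₁ := H _ (mem_BGens.2 (Or.inl ⟨⟨0, hm⟩, rfl, rfl⟩))
      have h₂ := combLen_signGen (z := ⟨0, hm⟩) rfl β
      split_ifs at h₂ with h₃
      · omega
      · simpa using h₃
    | succ m ih => exact (step ⟨m, by omega⟩ ⟨m + 1, hm⟩ rfl (ih _)).2
  have hmono : StrictMono β.1.symm := by
    cases n with
    | zero => exact fun i => i.elim0
    | succ n => exact Fin.strictMono_iff_lt_succ.2 fun i => (step _ _ (by simp) (pos _ _)).1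
  have hσ : β.1.symm = 1 := by
    ext1 i
    exact congr_fun ((hmono.range_inj strictMono_id).1
      (by simp [β.1.symm.surjective.range_eq])) i
  have hσ' : β.1 = 1 := by
    rw [← Equiv.symm_symm β.1, hσ]
    rfl
  refine Prod.ext hσ' (funext fun i => ?_)
  simpa [hσ, bone] using pos i i.2

lemma combLen_bone (n : ℕ) : combLen (bone n) = 0 := by
  refine sum_eq_zero fun j _ => ?_
  have : ({i | i < j} : Finset (Fin n)) = Iio j := by ext; simp
  simp [lenTerm, bone, smallerBefore, this]

lemma combLen_foldr_le {n : ℕ} (l : List (Bgrp n)) (hl : ∀ g ∈ l, g ∈ BGens n) :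
    combLen (l.foldr bmul (bone n)) ≤ l.length := by
  induction l with
  | nil => simp [combLen_bone]
  | cons g l ih =>
    rw [List.forall_mem_cons] at hl
    exact (combLen_bmul_le hl.1 _).trans (Nat.succ_le_succ (ih hl.2))

lemma exists_word {n : ℕ} (m : ℕ) (β : Bgrp n) (hm : combLen β = m) :
    ∃ l : List (Bgrp n), l.length = m ∧ (∀ g ∈ l, g ∈ BGens n) ∧
      l.foldr bmul (bone n) = β := by
  induction m using Nat.strong_induction_on generalizing β with
  | _ m ih =>
    by_cases hβ : β = bone n
    · subst hβ
      rw [combLen_bone] at hm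
      exact ⟨[], by simp [← hm]⟩
    · obtain ⟨g, hg, hlt⟩ := exists_combLen_bmul_lt hβ
      obtain ⟨l, hl, hmem, hprod⟩ := ih _ (hm ▸ hlt) (bmul g β) rfl
      have hle := combLen_bmul_le hg (bmul g β)
      rw [bmul_bmul_self hg] at hle
      refine ⟨g :: l, by simp only [List.length_cons]; omega,
        List.forall_mem_cons.2 ⟨hg, hmem⟩, ?_⟩
      rw [List.foldr_cons, hprod, bmul_bmul_self hg]

lemma lenB_eq_combLen {n : ℕ} (β : Bgrp n) : lenB β = combLen β := by
  have h := exists_word _ β rfl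
  refine le_antisymm (Nat.sInf_le h) ?_
  obtain ⟨l, hl, hmem, hprod⟩ := Nat.sInf_mem (⟨_, h⟩ : Set.Nonempty {k | ∃ l : List (Bgrp n),
    l.length = k ∧ (∀ g ∈ l, g ∈ BGens n) ∧ l.foldr bmul (bone n) = β})
  rw [lenB, ← hl]
  exact hprod ▸ combLen_foldr_le l hmem

/-! ### The flag-major index -/

/-- The rank of the entry at position `j` in the order `-1 ≺ ⋯ ≺ -n ≺ 1 ≺ ⋯ ≺ n`. -/
def rank {n : ℕ} (β : Bgrp n) (j : Fin n) : ℕ := (if β.2 j then 0 else n) + β.1 j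

lemma rank_lt {n : ℕ} (β : Bgrp n) (j : Fin n) : rank β j < 2 * n := by
  unfold rank
  split_ifs <;> omega

lemma precLt_wdw_iff {n : ℕ} (β : Bgrp n) (i j : Fin n) :
    precLt (wdw β i) (wdw β j) ↔ rank β i < rank β j := by
  unfold precLt wdw rank
  split_ifs <;> omega

lemma wdw_neg_iff {n : ℕ} (β : Bgrp n) (i : Fin n) : wdw β i < 0 ↔ β.2 i := by
  unfold wdw
  split_ifs <;> simp_all <;> omega

lemma N1_eq_sum {n : ℕ} (β : Bgrp n) : N1 β = ∑ i, if β.2 i then 1 else 0 := by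
  simp [N1, NegB, wdw_neg_iff]

lemma majB_eq_sum {n : ℕ} (β : Bgrp (n + 1)) :
    majB β = ∑ i : Fin n, if rank β i.succ < rank β i.castSucc then (i : ℕ) + 1 else 0 := by
  rw [majB, DesB, sum_filter, Nat.add_sub_cancel, ← Fin.sum_univ_eq_sum_range
    (fun i => if precLt (wdwN β (i + 1)) (wdwN β i) then i + 1 else 0)]
  refine sum_congr rfl fun i _ => ?_
  have h₁ : wdwN β (i + 1) = wdw β i.succ := dif_pos _
  have h₂ : wdwN β i = wdw β i.castSucc := dif_pos _
  simp only [h₁, h₂, precLt_wdw_iff]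

/-- The signed cyclic shift `1 ↦ 2 ↦ ⋯ ↦ n ↦ -1 ↦ ⋯ ↦ -n ↦ 1` of the values. -/
def shift {n : ℕ} (β : Bgrp (n + 1)) : Bgrp (n + 1) :=
  (finRotate (n + 1) * β.1, fun j => xor (β.2 j) (decide (β.1 j = Fin.last n)))

lemma shift_bijective {n : ℕ} : Function.Bijective (shift (n := n)) := by
  refine Finite.injective_iff_bijective.1 ?_
  rintro ⟨σ, ε⟩ ⟨σ', ε'⟩ h
  simp only [shift, Prod.mk.injEq, mul_right_inj] at h
  obtain ⟨rfl, h⟩ := h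
  simpa [funext_iff] using h

lemma rank_shift {n : ℕ} (β : Bgrp (n + 1)) (j : Fin (n + 1)) :
    rank (shift β) j = if rank β j = 2 * n + 1 then 0 else rank β j + 1 := by
  have h := coe_finRotate (β.1 j)
  have hl := (β.1 j).is_lt
  have hj : β.1 j = Fin.last n ↔ (β.1 j : ℕ) = n := by simp [Fin.ext_iff]
  simp only [hj] at h
  simp only [rank, shift, Equiv.Perm.mul_apply, h, hj]
  by_cases h' : (β.1 j : ℕ) = n
  · simp only [h', decide_true, Bool.xor_true, if_true]
    cases β.2 j <;> simp <;> omega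
  · simp only [h', decide_false, Bool.xor_false, if_false]
    split_ifs <;> omega

lemma rank_injective {n : ℕ} (β : Bgrp n) : Function.Injective (rank β) := by
  intro i j h
  unfold rank at h
  have := β.1.injective.eq_iff (a := i) (b := j)
  rw [← this, Fin.ext_iff]
  split_ifs at h <;> omega

lemma N1_shift {n : ℕ} (β : Bgrp (n + 1)) :
    if β.2 (β.1.symm (Fin.last n)) then N1 β = N1 (shift β) + 1 else N1 (shift β) = N1 β + 1 := by
  have key := sum_add_eq_sum_add (f := fun j => if (shift β).2 j then 1 else 0)
    (g := fun j => if β.2 j then 1 else 0) (β.1.symm (Fin.last n)) (fun j hj => by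
      have : β.1 j ≠ Fin.last n := fun h => hj (by simp [← h])
      simp [shift, this])
  rw [← N1_eq_sum, ← N1_eq_sum] at key
  split_ifs with h <;> simp [h, show (shift β).2 (β.1.symm (Fin.last n)) = !β.2 (β.1.symm (Fin.last n)) by simp [shift]]
    at key <;> omega

lemma sum_castSucc_eq {n : ℕ} {p : Fin (n + 1)} (hp : p ≠ Fin.last n) :
    ∑ i : Fin n, (if i.castSucc = p then (i : ℕ) + 1 else 0) = p + 1 := by
  have h := Fin.sum_univ_castSucc (fun j => if j = p then (j : ℕ) + 1 else 0)
  rw [sum_ite_eq' univ p, if_pos (mem_univ _), if_neg hp.symm] at h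
  exact h.symm

lemma sum_succ_eq {n : ℕ} (p : Fin (n + 1)) :
    ∑ i : Fin n, (if i.succ = p then (i : ℕ) + 1 else 0) = p := by
  have h := Fin.sum_univ_succ (fun j => if j = p then (j : ℕ) else 0)
  rw [sum_ite_eq' univ p, if_pos (mem_univ _)] at h
  simpa using h.symm

lemma majB_shift_of_neg {n : ℕ} {β : Bgrp (n + 1)} (h : β.2 (β.1.symm (Fin.last n))) :
    majB (shift β) = majB β := by
  have hr (j : Fin (n + 1)) : rank (shift β) j = rank β j + 1 := by
    rw [rank_shift, if_neg]
    intro hj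
    have hl := (β.1 j).is_lt
    have hβ : β.2 j = false := by
      by_contra hc
      simp only [rank, Bool.eq_true_of_not_eq_false hc, if_true] at hj
      omega
    have : β.1 j = Fin.last n := by
      simp only [rank, hβ] at hj
      simp [Fin.ext_iff] at hj ⊢
      omega
    simp [← this, hβ] at h
  simp [majB_eq_sum, hr]

lemma majB_shift_of_pos {n : ℕ} {β : Bgrp (n + 1)} (h : β.2 (β.1.symm (Fin.last n)) = false)
    (hp : β.1.symm (Fin.last n) ≠ Fin.last n) : majB β = majB (shift β) + 1 := by
  set p := β.1.symm (Fin.last n)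
  have hrp : rank β p = 2 * n + 1 := by
    simp [rank, h, p]
    omega
  have key : majB β + ∑ i : Fin n, (if i.succ = p then (i : ℕ) + 1 else 0) =
      majB (shift β) + ∑ i : Fin n, (if i.castSucc = p then (i : ℕ) + 1 else 0) := by
    rw [majB_eq_sum, majB_eq_sum, ← sum_add_distrib, ← sum_add_distrib]
    refine sum_congr rfl fun i _ => ?_
    have h₁ := (rank_injective β).eq_iff (a := i.succ) (b := p)
    have h₂ := (rank_injective β).eq_iff (a := i.castSucc) (b := p)
    have h₃ := rank_lt β i.succ
    have h₄ := rank_lt β i.castSucc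
    have h₅ : rank β i.castSucc ≠ rank β i.succ := by
      rw [(rank_injective β).ne_iff]
      exact (Fin.castSucc_lt_succ).ne
    simp only [rank_shift, ← h₁, ← h₂, hrp]
    split_ifs <;> omega
  rw [sum_castSucc_eq hp, sum_succ_eq] at key
  omega

lemma fmaj_shift {n : ℕ} {β : Bgrp (n + 1)} (h : rank β (Fin.last n) ≠ 2 * n + 1) :
    fmaj β = fmaj (shift β) + 1 := by
  have hN := N1_shift β
  unfold fmaj
  split_ifs at hN with hs
  · rw [majB_shift_of_neg hs]
    omega
  · rw [majB_shift_of_pos (by simpa using hs)]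
    · omega
    · intro hp
      rw [hp] at hs
      rw [Equiv.symm_apply_eq] at hp
      apply h
      simp [rank, hs, ← hp]
      omega

/-- The generating function of `fmaj` over signed permutations whose last entry has rank `k`. -/
noncomputable def fmajFiber (n k : ℕ) : Polynomial ℤ :=
  ∑ β : Bgrp (n + 1), if rank β (Fin.last n) = k then X ^ fmaj β else 0

lemma fmajFiber_step {n k : ℕ} (hk : k < 2 * n + 1) :
    fmajFiber n k = X * fmajFiber n (k + 1) := by
  unfold fmajFiber
  rw [mul_sum, ← shift_bijective.sum_comp (fun β => X * if rank β (Fin.last n) = k + 1 then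
    (X : Polynomial ℤ) ^ fmaj β else 0)]
  refine sum_congr rfl fun β _ => ?_
  rw [rank_shift]
  by_cases h : rank β (Fin.last n) = 2 * n + 1
  · simp [h, hk.ne']
  · by_cases h' : rank β (Fin.last n) = k
    · rw [if_pos h', if_neg h, if_pos (by rw [h']), fmaj_shift h, pow_succ']
    · simp [h, h']

lemma fmajFiber_eq {n : ℕ} (j : ℕ) (hj : j ≤ 2 * n + 1) :
    fmajFiber n (2 * n + 1 - j) = X ^ j * fmajFiber n (2 * n + 1) := by
  induction j with
  | zero => simp
  | succ j ih =>
    rw [fmajFiber_step (by omega), show 2 * n + 1 - (j + 1) + 1 = 2 * n + 1 - j by omega,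
      ih (by omega), pow_succ', mul_assoc]

lemma sum_pow_fmaj_eq_sum_fmajFiber (n : ℕ) :
    ∑ β : Bgrp (n + 1), (X : Polynomial ℤ) ^ fmaj β =
      ∑ k ∈ range (2 * (n + 1)), fmajFiber n k := by
  unfold fmajFiber
  rw [sum_comm]
  refine sum_congr rfl fun β _ => ?_
  rw [sum_ite_eq, if_pos (mem_range.2 (rank_lt _ _))]

lemma rank_snoc_last {n : ℕ} (p : Fin (n + 1) × Bool) (β : Bgrp n) :
    rank (snoc (p, β)) (Fin.last n) = 2 * n + 1 ↔ p = (Fin.last n, false) := by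
  obtain ⟨a, s⟩ := p
  cases s <;> simp [rank, snoc, permSnoc_last, Fin.ext_iff] <;> omega

lemma wdw_snoc_castSucc {n : ℕ} (β : Bgrp n) (i : Fin n) :
    wdw (snoc ((Fin.last n, false), β)) i.castSucc = wdw β i := by
  simp [wdw, snoc, permSnoc_castSucc]

lemma N1_snoc_last {n : ℕ} (β : Bgrp n) : N1 (snoc ((Fin.last n, false), β)) = N1 β := by
  simp [N1_eq_sum, Fin.sum_univ_castSucc, snoc, -sum_boole]

lemma DesB_snoc_last {n : ℕ} (β : Bgrp n) :
    DesB (snoc ((Fin.last n, false), β)) = DesB β := by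
  have hw (i : ℕ) (hi : i < n) : wdwN (snoc ((Fin.last n, false), β)) i = wdwN β i := by
    rw [wdwN, wdwN, dif_pos hi, dif_pos (by omega)]
    exact wdw_snoc_castSucc β ⟨i, hi⟩
  ext i
  simp only [DesB, mem_filter, mem_range, Nat.add_sub_cancel]
  rcases lt_or_ge (i + 1) n with h | h
  · rw [hw _ h, hw _ (by omega)]
    simp only [show i < n by omega, show i < n - 1 by omega]
  · simp only [show ¬ i < n - 1 by omega, false_and, iff_false, not_and]
    intro hi
    obtain rfl : n = i + 1 := by omega
    have h₁ : wdwN (snoc ((Fin.last (i + 1), false), β)) (i + 1) =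
      wdw (snoc ((Fin.last (i + 1), false), β)) (Fin.last (i + 1)) := dif_pos _
    have h₂ : wdwN (snoc ((Fin.last (i + 1), false), β)) i =
      wdw (snoc ((Fin.last (i + 1), false), β)) (Fin.last i).castSucc := dif_pos _
    rw [h₁, h₂, precLt_wdw_iff, (rank_snoc_last _ _).2 rfl]
    have := rank_lt (snoc ((Fin.last (i + 1), false), β)) (Fin.last i).castSucc
    omega

lemma fmajFiber_top (n : ℕ) :
    fmajFiber n (2 * n + 1) = ∑ β : Bgrp n, (X : Polynomial ℤ) ^ fmaj β := by
  rw [fmajFiber, sum_eq_sum_snoc, sum_eq_single (Fin.last n, false)]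
  · refine sum_congr rfl fun β _ => ?_
    rw [if_pos ((rank_snoc_last _ _).2 rfl), fmaj, fmaj, majB, majB, DesB_snoc_last, N1_snoc_last]
  · exact fun p _ hp => sum_eq_zero fun β _ => if_neg (mt (rank_snoc_last _ _).1 hp)
  · simp

lemma sum_pow_fmaj_succ (n : ℕ) :
    ∑ β : Bgrp (n + 1), (X : Polynomial ℤ) ^ fmaj β =
      (∑ k ∈ range (2 * (n + 1)), X ^ k) * ∑ β : Bgrp n, (X : Polynomial ℤ) ^ fmaj β := by
  rw [sum_pow_fmaj_eq_sum_fmajFiber, ← fmajFiber_top, sum_mul, ← sum_range_reflect]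
  refine sum_congr rfl fun j hj => ?_
  rw [mem_range] at hj
  rw [← fmajFiber_eq j (by omega)]
  congr 1

lemma sum_pow_fmaj_eq_sum_pow_combLen (n : ℕ) :
    ∑ β : Bgrp n, (X : Polynomial ℤ) ^ fmaj β = ∑ β : Bgrp n, (X : Polynomial ℤ) ^ combLen β := by
  induction n with
  | zero => simp [fmaj, majB, DesB, N1, NegB, combLen]
  | succ n ih => rw [sum_pow_fmaj_succ, sum_pow_combLen_succ, ih]

end Hyperoctahedral

/-- The flag-major index is equidistributed with Coxeter length on `B_n`. -/
theorem stmt4 (n : ℕ) (hn : 0 < n) :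
    ∑ β : Bgrp n, (X : Polynomial ℤ) ^ fmaj β = ∑ β : Bgrp n, (X : Polynomial ℤ) ^ lenB β := by
  simp only [Hyperoctahedral.lenB_eq_combLen]
  exact Hyperoctahedral.sum_pow_fmaj_eq_sum_pow_combLen n
end

section
/- For every n ∈ ℙ, ∑_{β ∈ B_n} (-1)^{inv(|β|)} q^{fmaj(β)} = [2]_q [4]_{-q} [6]_q ⋯ [2n]_{(-1)^{n-1} q}, where |β| is the permutation (|β(1)|, ..., |β(n)|) ∈ S_n. -/
open Finset Polynomial

/-- The permutation of `Fin (n + 1)` whose last value is `k` and whose other values are in the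
same relative order as those of `σ`. -/
def permSnoc {n : ℕ} (k : Fin (n + 1)) (σ : Equiv.Perm (Fin n)) : Equiv.Perm (Fin (n + 1)) :=
  ((finSuccEquiv' (Fin.last n)).trans (Equiv.optionCongr σ)).trans (finSuccEquiv' k).symm

@[simp] theorem permSnoc_last {n : ℕ} (k : Fin (n + 1)) (σ : Equiv.Perm (Fin n)) :
    permSnoc k σ (Fin.last n) = k := by
  simp [permSnoc]

@[simp] theorem permSnoc_castSucc {n : ℕ} (k : Fin (n + 1)) (σ : Equiv.Perm (Fin n))
    (i : Fin n) : permSnoc k σ i.castSucc = k.succAbove (σ i) := by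
  simp [permSnoc, finSuccEquiv'_last_apply_castSucc]

/-- The signed permutation whose last letter is `±(k + 1)` (negative when `b` is true) and whose
other letters are standardised to `β`. -/
def signedSnoc {n : ℕ} (k : Fin (n + 1)) (b : Bool) (β : Bgrp n) : Bgrp (n + 1) :=
  (permSnoc k β.1, Fin.snoc β.2 b)

theorem signedSnoc_bijective (n : ℕ) :
    Function.Bijective
      (fun p : (Fin (n + 1) × Bool) × Bgrp n => signedSnoc p.1.1 p.1.2 p.2) := by
  rw [Fintype.bijective_iff_injective_and_card]
  constructor
  · rintro ⟨⟨k, b⟩, σ, s⟩ ⟨⟨k', b'⟩, σ', s'⟩ h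
    simp only [signedSnoc, Prod.mk.injEq] at h
    obtain ⟨h1, h2⟩ := h
    have hk : k = k' := by
      simpa using congrArg (fun e : Equiv.Perm (Fin (n + 1)) => e (Fin.last n)) h1
    subst hk
    have hσ : σ = σ' := by
      ext1 i
      simpa using congrArg (fun e : Equiv.Perm (Fin (n + 1)) => e i.castSucc) h1
    have hb : b = b' := by
      simpa using congrFun h2 (Fin.last n)
    have hs : s = s' := by
      funext i
      simpa using congrFun h2 i.castSucc
    simp [hσ, hb, hs]
  · simp [Fintype.card_perm, Nat.factorial_succ, pow_succ]
    ring

theorem sum_eq_sum_signedSnoc {M : Type*} [AddCommMonoid M] {n : ℕ} (f : Bgrp (n + 1) → M) :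
    ∑ β, f β = ∑ k : Fin (n + 1), ∑ b : Bool, ∑ β : Bgrp n, f (signedSnoc k b β) := by
  rw [← (signedSnoc_bijective n).sum_comp f, Fintype.sum_prod_type, Fintype.sum_prod_type]

theorem invS_eq_sum {n : ℕ} (σ : Equiv.Perm (Fin n)) :
    invS σ = ∑ i, ∑ j, if i < j ∧ σ j < σ i then 1 else 0 := by
  rw [invS, card_filter, Fintype.sum_prod_type]

theorem invS_permSnoc {n : ℕ} (k : Fin (n + 1)) (σ : Equiv.Perm (Fin n)) :
    invS (permSnoc k σ) = invS σ + (n - k) := by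
  have hlast : ∑ i : Fin n, (if k < k.succAbove (σ i) then 1 else 0) = n - (k : ℕ) := by
    rw [Equiv.sum_comp σ (fun j => if k < k.succAbove j then 1 else 0)]
    simp only [Fin.lt_succAbove_iff_le_castSucc, Fin.le_def, Fin.val_castSucc]
    rw [Fin.sum_univ_eq_sum_range (fun j => if (k : ℕ) ≤ j then 1 else 0), ← card_filter]
    have : (range n).filter (fun j => (k : ℕ) ≤ j) = Ico (k : ℕ) n := by
      ext j
      simp [and_comm]
    rw [this, Nat.card_Ico]
  rw [invS_eq_sum, invS_eq_sum, ← hlast]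
  simp [-sum_boole, Fin.sum_univ_castSucc, sum_add_distrib, Fin.castSucc_lt_last,
    Fin.succAbove_lt_succAbove_iff, Fin.not_lt.2 (Fin.le_last _)]

@[simp] theorem wdw_signedSnoc_castSucc {n : ℕ} (k : Fin (n + 1)) (b : Bool) (β : Bgrp n)
    (i : Fin n) : wdw (signedSnoc k b β) i.castSucc =
      (if β.2 i then -1 else 1) * ((k.succAbove (β.1 i) : ℤ) + 1) := by
  simp [wdw, signedSnoc]

@[simp] theorem wdw_signedSnoc_last {n : ℕ} (k : Fin (n + 1)) (b : Bool) (β : Bgrp n) :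
    wdw (signedSnoc k b β) (Fin.last n) = (if b then -1 else 1) * ((k : ℤ) + 1) := by
  simp [wdw, signedSnoc]

theorem signed_neg_iff (b : Bool) (x : ℕ) : (if b then -1 else 1) * ((x : ℤ) + 1) < 0 ↔ b := by
  cases b <;> simp <;> omega

theorem precLt_signed_iff (b c : Bool) (x y : ℕ) :
    precLt ((if b then -1 else 1) * ((x : ℤ) + 1)) ((if c then -1 else 1) * ((y : ℤ) + 1)) ↔
      (b ∧ ¬c) ∨ (b = c ∧ x < y) := by
  cases b <;> cases c <;> simp [precLt] <;> omega

theorem N1_eq_sum {n : ℕ} (β : Bgrp n) : N1 β = ∑ i, if β.2 i then 1 else 0 := by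
  simp only [N1, NegB, wdw, signed_neg_iff, card_filter]

theorem N1_signedSnoc {n : ℕ} (k : Fin (n + 1)) (b : Bool) (β : Bgrp n) :
    N1 (signedSnoc k b β) = N1 β + if b then 1 else 0 := by
  simp [-sum_boole, N1_eq_sum, signedSnoc, Fin.sum_univ_castSucc]

theorem majB_succ {n : ℕ} (β : Bgrp (n + 1)) :
    majB β = ∑ i : Fin n, if precLt (wdw β i.succ) (wdw β i.castSucc) then (i : ℕ) + 1 else 0 := by
  rw [majB, DesB, sum_filter, Nat.add_sub_cancel, ← Fin.sum_univ_eq_sum_range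
    (fun i => if precLt (wdwN β (i + 1)) (wdwN β i) then i + 1 else 0)]
  refine sum_congr rfl fun i _ => ?_
  have h1 : wdwN β ((i : ℕ) + 1) = wdw β i.succ := by simp [wdwN, Fin.succ]
  have h2 : wdwN β (i : ℕ) = wdw β i.castSucc := by
    simp [wdwN, Nat.lt_succ_of_lt i.isLt, Fin.castSucc, Fin.castAdd, Fin.castLE]
  rw [h1, h2]

theorem majB_signedSnoc {n : ℕ} (k : Fin (n + 2)) (b : Bool) (β : Bgrp (n + 1)) :
    majB (signedSnoc k b β) = majB β +
      if (b ∧ ¬β.2 (Fin.last n)) ∨ (b = β.2 (Fin.last n) ∧ (k : ℕ) ≤ β.1 (Fin.last n))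
        then n + 1 else 0 := by
  rw [majB_succ, majB_succ, Fin.sum_univ_castSucc]
  congr 1
  · refine sum_congr rfl fun i _ => ?_
    simp only [← Fin.castSucc_succ, wdw_signedSnoc_castSucc, precLt_signed_iff, Fin.val_castSucc,
      ← Fin.lt_def, Fin.succAbove_lt_succAbove_iff]
    simp only [wdw, precLt_signed_iff, ← Fin.lt_def]
  · simp only [Fin.succ_last, wdw_signedSnoc_castSucc, wdw_signedSnoc_last, precLt_signed_iff,
      ← Fin.lt_def, Fin.lt_succAbove_iff_le_castSucc, Fin.le_def, Fin.val_castSucc, Fin.val_last]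

/-- The signed weight `(-1)^{inv |β|} q^{fmaj β}`. -/
noncomputable def signedWeight {n : ℕ} (β : Bgrp n) : Polynomial ℤ :=
  (-1) ^ invS β.1 * X ^ fmaj β

theorem signedWeight_signedSnoc_zero (k : Fin 1) (b : Bool) (β : Bgrp 0) :
    signedWeight (signedSnoc k b β) = X ^ (if b then 1 else 0) := by
  have h0 : invS β.1 = 0 := by simp [invS_eq_sum]
  have h1 : invS (signedSnoc k b β).1 = 0 := by
    simp [signedSnoc, invS_permSnoc, h0]
  have h2 : N1 β = 0 := by simp [N1_eq_sum]
  simp [signedWeight, h1, fmaj, majB_succ, N1_signedSnoc, h2]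

theorem signedWeight_signedSnoc_signedSnoc {n : ℕ} (k : Fin (n + 2)) (b : Bool)
    (l : Fin (n + 1)) (c : Bool) (β : Bgrp n) :
    signedWeight (signedSnoc k b (signedSnoc l c β)) =
      (-1) ^ (n + 1 - k) * X ^ (if b then 1 else 0) *
        (if (b ∧ ¬c) ∨ (b = c ∧ (k : ℕ) ≤ l) then X ^ (2 * (n + 1)) else 1) *
        signedWeight (signedSnoc l c β) := by
  have h1 : (signedSnoc k b (signedSnoc l c β)).1 = permSnoc k (signedSnoc l c β).1 := rfl
  have h2 : (signedSnoc l c β).1 (Fin.last n) = l := by simp [signedSnoc]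
  have h3 : (signedSnoc l c β).2 (Fin.last n) = c := by simp [signedSnoc]
  rw [signedWeight, signedWeight, fmaj, fmaj, h1, invS_permSnoc, majB_signedSnoc, N1_signedSnoc,
    h2, h3]
  split_ifs <;> ring

theorem sum_range_ite_mul_pow {R : Type*} [CommRing R] (y : R) (m j : ℕ) (hj : j ≤ m) :
    ∑ i ∈ range m, (if j ≤ i then y ^ m else 1) * y ^ (m - 1 - i) =
      y ^ (m - j) * ∑ i ∈ range m, y ^ i := by
  obtain ⟨d, rfl⟩ := Nat.exists_eq_add_of_le hj
  rw [sum_range_add]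
  have h1 : ∑ i ∈ range j, (if j ≤ i then y ^ (j + d) else 1) * y ^ (j + d - 1 - i) =
      y ^ d * ∑ i ∈ range j, y ^ i := by
    rw [← sum_range_reflect (fun i => y ^ i), mul_sum]
    refine sum_congr rfl fun i hi => ?_
    have hi := mem_range.1 hi
    rw [if_neg (by omega), one_mul, ← pow_add]
    congr 1
    omega
  have h2 : ∑ i ∈ range d, (if j ≤ j + i then y ^ (j + d) else 1) * y ^ (j + d - 1 - (j + i)) =
      y ^ d * ∑ i ∈ range d, y ^ (j + i) := by
    rw [← sum_range_reflect (fun i => y ^ (j + i)), mul_sum]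
    refine sum_congr rfl fun i hi => ?_
    have hi := mem_range.1 hi
    rw [if_pos (by omega), ← pow_add, ← pow_add]
    congr 1
    omega
  rw [h1, h2, sum_range_add, Nat.add_sub_cancel_left, mul_add]

/-- The powers of `y` attached to the last letters `±(k + 1)` exhaust `0, …, 2n + 1`. -/
theorem sum_letter_pow (n : ℕ) (y : Polynomial ℤ) :
    ∑ k : Fin (n + 1), ∑ b : Bool, y ^ (if b then 2 * n + 1 - (k : ℕ) else n - k) =
      qpoly (2 * (n + 1)) y := by
  simp only [Fintype.sum_bool, if_true, Bool.false_eq_true, if_false]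
  rw [Fin.sum_univ_eq_sum_range (fun k => y ^ (2 * n + 1 - k) + y ^ (n - k)), sum_add_distrib,
    qpoly, ← sum_range_reflect (fun k => y ^ k), two_mul (n + 1), sum_range_add _ (n + 1) (n + 1)]
  refine congrArg₂ (· + ·) (sum_congr rfl fun i hi => ?_) (sum_congr rfl fun i hi => ?_) <;>
    congr 1 <;> omega

/-- Appending a letter `±(k + 1)` after each possible last letter `±(l + 1)`: the factor
`y ^ (2 * (n + 1))` records a descent at the end. -/
theorem sum_letter_descent_pow (n k : ℕ) (hk : k ≤ n + 1) (b : Bool) (y : Polynomial ℤ) :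
    ∑ l : Fin (n + 1), ∑ c : Bool,
      (if (b ∧ ¬c) ∨ (b = c ∧ k ≤ (l : ℕ)) then y ^ (2 * (n + 1)) else 1) *
        y ^ (if c then 2 * n + 1 - (l : ℕ) else n - l) =
      y ^ (if b then 2 * (n + 1) - k else n + 1 - k) * qpoly (2 * (n + 1)) y := by
  rw [Fin.sum_univ_eq_sum_range (fun l => ∑ c : Bool,
    (if (b ∧ ¬c) ∨ (b = c ∧ k ≤ l) then y ^ (2 * (n + 1)) else 1) *
      y ^ (if c then 2 * n + 1 - l else n - l))]
  simp only [Fintype.sum_bool, if_true, Bool.false_eq_true, if_false, sum_add_distrib]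
  have key := sum_range_ite_mul_pow y (2 * (n + 1)) (if b then k else n + 1 + k)
    (by split_ifs <;> omega)
  have hexp : (if b then 2 * (n + 1) - k else n + 1 - k) =
      2 * (n + 1) - (if b then k else n + 1 + k) := by
    split_ifs <;> omega
  rw [qpoly, hexp, ← key]
  rw [show range (2 * (n + 1)) = range ((n + 1) + (n + 1)) by rw [two_mul],
    sum_range_add _ (n + 1) (n + 1)]
  refine congrArg₂ (· + ·) (sum_congr rfl fun i hi => ?_) (sum_congr rfl fun i hi => ?_)
  · have hi := mem_range.1 hi
    rw [show 2 * (n + 1) - 1 - i = 2 * n + 1 - i by omega]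
    cases b
    · have : ¬ n + 1 + k ≤ i := by omega
      simp [this]
    · simp
  · have hi := mem_range.1 hi
    congr 1
    · cases b
      · simp
      · have : k ≤ n + 1 + i := by omega
        simp [this]
    · congr 1
      omega

theorem sum_signedWeight_succ_of_signedSnoc {n : ℕ}
    (h : ∀ (k : Fin (n + 1)) (b : Bool), ∑ β : Bgrp n, signedWeight (signedSnoc k b β) =
      (∑ β : Bgrp n, signedWeight β) *
        ((-1) ^ n * X) ^ (if b then 2 * n + 1 - (k : ℕ) else n - k)) :
    ∑ β : Bgrp (n + 1), signedWeight β =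
      (∑ β : Bgrp n, signedWeight β) * qpoly (2 * (n + 1)) ((-1) ^ n * X) := by
  simp_rw [sum_eq_sum_signedSnoc, h, ← mul_sum, sum_letter_pow]

theorem sum_signedWeight_signedSnoc (n : ℕ) (k : Fin (n + 1)) (b : Bool) :
    ∑ β : Bgrp n, signedWeight (signedSnoc k b β) =
      (∑ β : Bgrp n, signedWeight β) *
        ((-1) ^ n * X) ^ (if b then 2 * n + 1 - (k : ℕ) else n - k) := by
  induction n generalizing b with
  | zero =>
    have h0 : ∀ β : Bgrp 0, signedWeight β = 1 := fun β => by
      simp [signedWeight, invS_eq_sum, fmaj, majB, DesB, N1_eq_sum]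
    simp [signedWeight_signedSnoc_zero, h0]
  | succ n ih =>
    rw [sum_signedWeight_succ_of_signedSnoc ih, sum_eq_sum_signedSnoc]
    simp_rw [signedWeight_signedSnoc_signedSnoc, ← mul_sum, ih]
    have hpow : (X : Polynomial ℤ) ^ (2 * (n + 1)) = ((-1) ^ n * X) ^ (2 * (n + 1)) := by
      rw [mul_pow, ← pow_mul, mul_left_comm, pow_mul (-1)]
      simp
    have hk : (k : ℕ) ≤ n + 1 := by omega
    have key := sum_letter_descent_pow n k hk b ((-1) ^ n * X)
    have hsign : (-1) ^ (n + 1 - (k : ℕ)) * (X : Polynomial ℤ) ^ (if b then 1 else 0) *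
        ((-1) ^ n * X) ^ (if b then 2 * (n + 1) - (k : ℕ) else n + 1 - k) =
        ((-1) ^ (n + 1) * X) ^ (if b then 2 * (n + 1) + 1 - (k : ℕ) else n + 1 - k) := by
      obtain ⟨d, hd⟩ := Nat.exists_eq_add_of_le hk
      have e1 : n + 1 - (k : ℕ) = d := by omega
      have e2 : 2 * (n + 1) - (k : ℕ) = n + 1 + d := by omega
      have e3 : 2 * (n + 1) + 1 - (k : ℕ) = n + 1 + d + 1 := by omega
      rw [e1, e2, e3]
      cases b
      · simp only [Bool.false_eq_true, if_false]
        rw [pow_zero, mul_one, ← mul_pow]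
        ring
      · simp only [if_true]
        have hx : ((-1) ^ (n + 1) * X : Polynomial ℤ) = -1 * ((-1) ^ n * X) := by ring
        have hX : (X : Polynomial ℤ) = (-1) ^ n * ((-1) ^ n * X) := by
          rw [← mul_assoc, ← mul_pow]
          simp
        rw [hx, mul_pow (-1)]
        generalize (-1) ^ n * (X : Polynomial ℤ) = y at hX ⊢
        rw [hX]
        ring
    rw [← hsign, mul_right_comm, mul_assoc (∑ β : Bgrp n, signedWeight β), mul_assoc _ _ (qpoly _ _),
      ← key, hpow]
    simp only [mul_sum, sum_mul]
    refine sum_congr rfl fun l _ => sum_congr rfl fun c _ => sum_congr rfl fun β _ => ?_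
    ring

/-- `∑_{β ∈ B_n} (-1)^{inv |β|} q^{fmaj β} = [2]_q[4]_{-q} ⋯ [2n]_{(-1)^{n-1} q}`;
here `|β|` is the underlying (unsigned) permutation of `β`. -/
theorem stmt8 (n : ℕ) (hn : 0 < n) :
    ∑ β : Bgrp n, (-1 : Polynomial ℤ) ^ invS β.1 * X ^ fmaj β =
      ∏ i ∈ range n, qpoly (2*(i+1)) ((-1 : Polynomial ℤ) ^ i * X) := by
  change ∑ β : Bgrp n, signedWeight β = _
  clear hn
  induction n with
  | zero => simp [signedWeight, invS_eq_sum, fmaj, majB, DesB, N1_eq_sum]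
  | succ n ih =>
    rw [sum_signedWeight_succ_of_signedSnoc (sum_signedWeight_signedSnoc n), ih, prod_range_succ]
end

section
/- For every n ∈ ℙ, ∑_{β ∈ B_{2n}} (-1)^{ℓ_B(β)} q^{fmaj(β)} = ∏_{i=1}^n (1 - q^{4i-2}) · ∑_{β ∈ B_n} q^{2·fmaj(β)}. -/
open Finset Polynomial

theorem bmul_assoc {n : ℕ} (a b c : Bgrp n) : bmul (bmul a b) c = bmul a (bmul b c) := by
  refine Prod.ext (mul_assoc _ _ _) (funext fun i => ?_)
  simp [bmul]

theorem bone_bmul {n : ℕ} (a : Bgrp n) : bmul (bone n) a = a := by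
  refine Prod.ext (one_mul _) (funext fun i => ?_)
  simp [bmul, bone]

theorem bmul_bone {n : ℕ} (a : Bgrp n) : bmul a (bone n) = a := by
  refine Prod.ext (mul_one _) (funext fun i => ?_)
  simp [bmul, bone]

/-- `β` is a product of Coxeter generators of `B n`. -/
def IsGenProd {n : ℕ} (β : Bgrp n) : Prop :=
  ∃ l : List (Bgrp n), (∀ g ∈ l, g ∈ BGens n) ∧ l.foldr bmul (bone n) = β

theorem foldr_bmul {n : ℕ} (l : List (Bgrp n)) (a : Bgrp n) :
    l.foldr bmul a = bmul (l.foldr bmul (bone n)) a := by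
  induction l with
  | nil => simp [bone_bmul]
  | cons b l ih => rw [List.foldr_cons, List.foldr_cons, ih, bmul_assoc]

theorem IsGenProd.bmul {n : ℕ} {a b : Bgrp n} (ha : IsGenProd a) (hb : IsGenProd b) :
    IsGenProd (bmul a b) := by
  obtain ⟨l, hl, rfl⟩ := ha
  obtain ⟨k, hk, rfl⟩ := hb
  refine ⟨l ++ k, fun g hg => ?_, ?_⟩
  · rcases List.mem_append.1 hg with h | h
    exacts [hl g h, hk g h]
  · rw [List.foldr_append, foldr_bmul]

theorem isGenProd_bone (n : ℕ) : IsGenProd (bone n) := ⟨[], by simp, rfl⟩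

theorem isGenProd_of_mem {n : ℕ} {b : Bgrp n} (hb : b ∈ BGens n) : IsGenProd b :=
  ⟨[b], by simpa using hb, bmul_bone b⟩

theorem isGenProd_perm {n : ℕ} (σ : Equiv.Perm (Fin n)) : IsGenProd (σ, fun _ => false) := by
  cases n with
  | zero =>
    rw [Subsingleton.elim σ 1]
    exact isGenProd_bone 0
  | succ m =>
    have hσ : σ ∈ Submonoid.closure
        (Set.range fun i : Fin m => Equiv.swap i.castSucc i.succ) := by
      rw [Equiv.Perm.mclosure_swap_castSucc_succ]; trivial
    induction hσ using Submonoid.closure_induction with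
    | mem x hx =>
      obtain ⟨i, rfl⟩ := hx
      exact isGenProd_of_mem (Or.inr ⟨i, by omega, rfl⟩)
    | one => exact isGenProd_bone _
    | mul x y _ _ hx hy => exact hx.bmul hy

theorem isGenProd_flip {n : ℕ} (j : Fin n) :
    IsGenProd ((1 : Equiv.Perm (Fin n)), fun i => decide (i = j)) := by
  have h0 : 0 < n := j.pos
  have h := ((isGenProd_perm (Equiv.swap ⟨0, h0⟩ j)).bmul
    (isGenProd_of_mem (Or.inl ⟨h0, rfl⟩))).bmul (isGenProd_perm (Equiv.swap ⟨0, h0⟩ j))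
  convert h using 1
  refine Prod.ext ?_ (funext fun i => ?_)
  · simp [_root_.bmul]
  · simp [_root_.bmul, Equiv.swap_apply_eq_iff]

theorem isGenProd_signs {n : ℕ} (s : Finset (Fin n)) :
    IsGenProd ((1 : Equiv.Perm (Fin n)), fun i => decide (i ∈ s)) := by
  induction s using Finset.induction_on with
  | empty => simpa [bone] using isGenProd_bone n
  | insert j s hj ih =>
    convert (isGenProd_flip j).bmul ih using 1
    refine Prod.ext (by simp [_root_.bmul]) (funext fun i => ?_)
    by_cases h : i = j
    · subst h; simp [_root_.bmul, hj]
    · simp [_root_.bmul, h]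

theorem isGenProd {n : ℕ} (β : Bgrp n) : IsGenProd β := by
  convert (isGenProd_perm β.1).bmul (isGenProd_signs (univ.filter fun i => β.2 i = true)) using 1
  refine Prod.ext (by simp [_root_.bmul]) (funext fun i => by simp [_root_.bmul])

/-- The one-dimensional character of `B n` sending every Coxeter generator to `-1`. -/
def signB {n : ℕ} (β : Bgrp n) : ℤ :=
  (Equiv.Perm.sign β.1 : ℤ) * ∏ i, if β.2 i then -1 else 1

theorem signB_bmul {n : ℕ} (a b : Bgrp n) : signB (bmul a b) = signB a * signB b := by
  have h : ∏ i, (if (bmul a b).2 i then (-1 : ℤ) else 1) =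
      (∏ i, if b.2 i then (-1 : ℤ) else 1) * ∏ i, if a.2 i then (-1 : ℤ) else 1 := by
    rw [← Equiv.prod_comp b.1 fun i => if a.2 i then (-1 : ℤ) else 1, ← prod_mul_distrib]
    refine prod_congr rfl fun i _ => ?_
    cases h1 : b.2 i <;> cases h2 : a.2 (b.1 i) <;> simp [bmul, h1, h2]
  rw [signB, h, signB, signB]
  simp only [bmul, Equiv.Perm.sign_mul, Units.val_mul]
  ring

theorem signB_bone (n : ℕ) : signB (bone n) = 1 := by simp [signB, bone]

theorem signB_of_mem_BGens {n : ℕ} {b : Bgrp n} (hb : b ∈ BGens n) : signB b = -1 := by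
  rcases hb with ⟨h, rfl⟩ | ⟨i, h, rfl⟩
  · simp [signB, prod_ite_eq']
  · rw [signB, Equiv.Perm.sign_swap (by simp)]
    simp

theorem signB_foldr {n : ℕ} (l : List (Bgrp n)) (hl : ∀ g ∈ l, g ∈ BGens n) :
    signB (l.foldr bmul (bone n)) = (-1) ^ l.length := by
  induction l with
  | nil => simpa using signB_bone n
  | cons b l ih =>
    rw [List.foldr_cons, signB_bmul, ih fun g hg => hl g (List.mem_cons_of_mem _ hg),
      signB_of_mem_BGens (hl b List.mem_cons_self), List.length_cons, pow_succ']

theorem neg_one_pow_lenB {n : ℕ} (β : Bgrp n) : (-1 : ℤ) ^ lenB β = signB β := by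
  have hne : {k | ∃ l : List (Bgrp n), l.length = k ∧ (∀ g ∈ l, g ∈ BGens n) ∧
      l.foldr bmul (bone n) = β}.Nonempty := by
    obtain ⟨l, hl, h⟩ := isGenProd β
    exact ⟨l.length, l, rfl, hl, h⟩
  obtain ⟨l, hlen, hl, h⟩ := Nat.sInf_mem hne
  rw [lenB, ← hlen, ← signB_foldr l hl, h]

theorem wdwN_eq {n : ℕ} (β : Bgrp n) {i : ℕ} (h : i < n) :
    wdwN β i = (if β.2 ⟨i, h⟩ then -1 else 1) * ((β.1 ⟨i, h⟩ : ℤ) + 1) := by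
  rw [wdwN, dif_pos h, wdw]

theorem wdw_neg_iff {n : ℕ} (β : Bgrp n) (i : Fin n) : wdw β i < 0 ↔ β.2 i = true := by
  rw [wdw]
  split_ifs with h <;> simp [h] <;> omega

theorem majB_eq_sum {n : ℕ} (β : Bgrp n) :
    majB β = ∑ i ∈ range (n - 1), if precLt (wdwN β (i + 1)) (wdwN β i) then i + 1 else 0 := by
  rw [majB, DesB, sum_filter]

/-- The equivalence `(j, b) ↦ 2 j + b` cutting `Fin (2 * n)` into `n` blocks of two. -/
def blockEquiv (n : ℕ) : Fin n × Bool ≃ Fin (2 * n) where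
  toFun x := ⟨2 * x.1 + x.2.toNat, by have := x.2.toNat_le; omega⟩
  invFun k := (⟨k / 2, by omega⟩, decide ((k : ℕ) % 2 = 1))
  left_inv := by
    rintro ⟨j, b⟩
    cases b <;> simp [Fin.ext_iff] <;> omega
  right_inv k := by
    rcases Nat.mod_two_eq_zero_or_one k with h | h <;> (simp [Fin.ext_iff, h]; omega)

theorem blockEquiv_val {n : ℕ} (x : Fin n × Bool) :
    (blockEquiv n x : ℕ) = 2 * x.1 + x.2.toNat := rfl

/-- The two entries of absolute value `2 i + 1`, `2 i + 2` are adjacent with equal signs. -/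
def Paired {n : ℕ} (β : Bgrp (2 * n)) (i : Fin n) : Prop :=
  ∃ k l : Fin (2 * n), (l : ℕ) = k + 1 ∧ (β.1 k : ℕ) / 2 = i ∧ (β.1 l : ℕ) / 2 = i ∧ β.2 k = β.2 l

/-- Exchange the entries of absolute value `2 i + 1` and `2 i + 2`, keeping signs in place. -/
def swapPair {n : ℕ} (i : Fin n) (β : Bgrp (2 * n)) : Bgrp (2 * n) :=
  (Equiv.swap (blockEquiv n (i, false)) (blockEquiv n (i, true)) * β.1, β.2)

theorem swapPair_swapPair {n : ℕ} (i : Fin n) (β : Bgrp (2 * n)) :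
    swapPair i (swapPair i β) = β := by
  simp [swapPair]

theorem signB_swapPair {n : ℕ} (i : Fin n) (β : Bgrp (2 * n)) :
    signB (swapPair i β) = -signB β := by
  have hne : blockEquiv n (i, false) ≠ blockEquiv n (i, true) := by simp
  rw [signB, signB, swapPair, Equiv.Perm.sign_mul, Equiv.Perm.sign_swap hne]
  simp only [neg_mul, one_mul, Units.val_neg]

theorem swapPair_apply {n : ℕ} (i : Fin n) (β : Bgrp (2 * n)) (k : Fin (2 * n)) :
    ((swapPair i β).1 k : ℕ) = if (β.1 k : ℕ) = 2 * i then 2 * (i : ℕ) + 1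
      else if (β.1 k : ℕ) = 2 * i + 1 then 2 * (i : ℕ) else (β.1 k : ℕ) := by
  simp only [swapPair, Equiv.Perm.mul_apply, Equiv.swap_apply_def, Fin.ext_iff, blockEquiv_val]
  simp only [Bool.toNat_false, Bool.toNat_true, add_zero]
  split_ifs <;> simp [blockEquiv_val]

theorem paired_swapPair {n : ℕ} (i j : Fin n) (β : Bgrp (2 * n)) :
    Paired (swapPair i β) j ↔ Paired β j := by
  have h (k : Fin (2 * n)) : ((swapPair i β).1 k : ℕ) / 2 = (β.1 k : ℕ) / 2 := by
    rw [swapPair_apply]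
    split_ifs <;> omega
  simp only [Paired, h]
  rfl

theorem precLt_signed_swap_iff {a b a' b' c : ℕ} {s t : Bool}
    (h : ¬ (a / 2 = c ∧ b / 2 = c ∧ s = t))
    (ha : a' = if a = 2 * c then 2 * c + 1 else if a = 2 * c + 1 then 2 * c else a)
    (hb : b' = if b = 2 * c then 2 * c + 1 else if b = 2 * c + 1 then 2 * c else b) :
    precLt ((if t then -1 else 1) * ((b' : ℤ) + 1)) ((if s then -1 else 1) * ((a' : ℤ) + 1)) ↔
      precLt ((if t then -1 else 1) * ((b : ℤ) + 1)) ((if s then -1 else 1) * ((a : ℤ) + 1)) := by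
  unfold precLt
  cases s <;> cases t <;>
    simp only [if_true, if_false, Bool.false_eq_true, Bool.true_eq_false, one_mul, neg_one_mul,
      and_true, and_false, not_false_eq_true] at h ⊢ <;>
    split_ifs at ha hb <;> omega

theorem fmaj_swapPair {n : ℕ} {i : Fin n} {β : Bgrp (2 * n)} (hi : ¬ Paired β i) :
    fmaj (swapPair i β) = fmaj β := by
  have hN : N1 (swapPair i β) = N1 β := by
    rw [N1_eq_sum, N1_eq_sum]; rfl
  have hM : majB (swapPair i β) = majB β := by
    rw [majB_eq_sum, majB_eq_sum]
    refine sum_congr rfl fun k hk => ?_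
    rw [mem_range] at hk
    have hk1 : k + 1 < 2 * n := by omega
    have hk0 : k < 2 * n := by omega
    have hP : ¬ ((β.1 ⟨k, hk0⟩ : ℕ) / 2 = i ∧ (β.1 ⟨k + 1, hk1⟩ : ℕ) / 2 = i ∧
        β.2 ⟨k, hk0⟩ = β.2 ⟨k + 1, hk1⟩) := fun h => hi ⟨_, _, rfl, h⟩
    have key : precLt (wdwN (swapPair i β) (k + 1)) (wdwN (swapPair i β) k) ↔
        precLt (wdwN β (k + 1)) (wdwN β k) := by
      rw [wdwN_eq _ hk1, wdwN_eq _ hk0, wdwN_eq _ hk1, wdwN_eq _ hk0]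
      exact precLt_signed_swap_iff hP (swapPair_apply i β _) (swapPair_apply i β _)
    simp only [key]
  rw [fmaj, fmaj, hN, hM]

open Classical in
/-- The indices of the pairs of absolute values that are not paired in `β`. -/
noncomputable def unpaired {n : ℕ} (β : Bgrp (2 * n)) : Finset (Fin n) :=
  univ.filter fun i => ¬ Paired β i

theorem mem_unpaired {n : ℕ} {β : Bgrp (2 * n)} {i : Fin n} : i ∈ unpaired β ↔ ¬ Paired β i := by
  simp [unpaired]

theorem unpaired_swapPair {n : ℕ} (i : Fin n) (β : Bgrp (2 * n)) :
    unpaired (swapPair i β) = unpaired β := by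
  ext j
  rw [mem_unpaired, mem_unpaired, paired_swapPair]

theorem sum_unpaired_eq_zero {n : ℕ} {R : Type*} [CommRing R] (q : R) :
    ∑ β : Bgrp (2 * n) with (unpaired β).Nonempty, (signB β : R) * q ^ fmaj β = 0 := by
  have hfil {β : Bgrp (2 * n)} (h : β ∈ univ.filter fun β => (unpaired β).Nonempty) :
      (unpaired β).Nonempty := (mem_filter.1 h).2
  refine sum_involution (fun β h => swapPair ((unpaired β).min' (hfil h)) β) ?_ ?_ ?_ ?_
  · intro β h
    rw [signB_swapPair, fmaj_swapPair (mem_unpaired.1 (min'_mem _ _))]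
    push_cast
    ring
  · intro β h _ he
    have h2 := congrArg signB he
    rw [signB_swapPair] at h2
    have h3 : signB β ≠ 0 := by
      rw [← neg_one_pow_lenB]
      exact pow_ne_zero _ (by norm_num)
    omega
  · intro β h
    rw [mem_filter, unpaired_swapPair]
    exact ⟨mem_univ _, hfil h⟩
  · intro β h
    simp only [unpaired_swapPair, swapPair_swapPair]

/-- Replace the entry `±v` of `β` at position `j` by the block `±(2 v - 1), ±(2 v)`, in this order
or, if `c j` holds, in the opposite order. -/
def inflate {n : ℕ} (β : Bgrp n) (c : Fin n → Bool) : Bgrp (2 * n) :=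
  ((blockEquiv n).permCongr (Equiv.prodCongrLeft (fun _ => β.1) *
    Equiv.prodCongrRight fun j => if c j then Equiv.swap false true else 1),
    fun k => β.2 ((blockEquiv n).symm k).1)

theorem inflate_fst {n : ℕ} (β : Bgrp n) (c : Fin n → Bool) (j : Fin n) (b : Bool) :
    (inflate β c).1 (blockEquiv n (j, b)) = blockEquiv n (β.1 j, xor b (c j)) := by
  rw [inflate, Equiv.permCongr_apply, Equiv.symm_apply_apply]
  cases b <;> cases h : c j <;> simp [h]

theorem inflate_snd {n : ℕ} (β : Bgrp n) (c : Fin n → Bool) (j : Fin n) (b : Bool) :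
    (inflate β c).2 (blockEquiv n (j, b)) = β.2 j := by
  simp [inflate]

theorem signB_inflate {n : ℕ} (β : Bgrp n) (c : Fin n → Bool) :
    signB (inflate β c) = ∏ j, if c j then -1 else 1 := by
  have h1 : ∏ k, (if (inflate β c).2 k then (-1 : ℤ) else 1) = 1 := by
    rw [← (blockEquiv n).prod_comp, Fintype.prod_prod_type]
    refine prod_eq_one fun j _ => ?_
    rw [Fintype.prod_bool, inflate_snd, inflate_snd]
    split_ifs <;> rfl
  have h2 : Equiv.Perm.sign (inflate β c).1 = ∏ j, if c j then -1 else 1 := by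
    rw [inflate, Equiv.Perm.sign_permCongr, Equiv.Perm.sign_mul, Equiv.Perm.sign_prodCongrLeft,
      Equiv.Perm.sign_prodCongrRight, Fintype.prod_bool, Int.units_mul_self, one_mul]
    refine prod_congr rfl fun j _ => ?_
    split_ifs
    · exact Equiv.Perm.sign_swap (by decide)
    · exact Equiv.Perm.sign_one
  rw [signB, h1, h2, mul_one, Units.coe_prod]
  refine prod_congr rfl fun j _ => ?_
  split_ifs <;> rfl

theorem N1_inflate {n : ℕ} (β : Bgrp n) (c : Fin n → Bool) : N1 (inflate β c) = 2 * N1 β := by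
  rw [N1_eq_sum, N1_eq_sum, ← (blockEquiv n).sum_comp, Fintype.sum_prod_type, mul_sum]
  refine sum_congr rfl fun j _ => ?_
  rw [Fintype.sum_bool, inflate_snd, inflate_snd, two_mul]

theorem wdwN_inflate {n : ℕ} (β : Bgrp n) (c : Fin n → Bool) {j : ℕ} (hj : j < n) (b : Bool) :
    wdwN (inflate β c) (2 * j + b.toNat) =
      (if β.2 ⟨j, hj⟩ then -1 else 1) *
        (2 * (β.1 ⟨j, hj⟩ : ℤ) + (xor b (c ⟨j, hj⟩)).toNat + 1) := by
  have hlt : 2 * j + b.toNat < 2 * n := by have := b.toNat_le; omega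
  have he : (⟨2 * j + b.toNat, hlt⟩ : Fin (2 * n)) = blockEquiv n (⟨j, hj⟩, b) := rfl
  rw [wdwN_eq _ hlt, he, inflate_fst, inflate_snd, blockEquiv_val]
  push_cast
  rfl

theorem sum_range_two_mul_sub_one {M : Type*} [AddCommMonoid M] (f : ℕ → M) (n : ℕ) :
    ∑ i ∈ range (2 * n - 1), f i =
      ∑ j ∈ range n, f (2 * j) + ∑ j ∈ range (n - 1), f (2 * j + 1) := by
  cases n with
  | zero => simp
  | succ m =>
    rw [show 2 * (m + 1) - 1 = 2 * m + 1 by omega, Nat.add_sub_cancel]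
    induction m with
    | zero => simp
    | succ m ih =>
      rw [show 2 * (m + 1) + 1 = 2 * m + 1 + 1 + 1 by omega, sum_range_succ, sum_range_succ, ih,
        sum_range_succ (fun j => f (2 * j)) (m + 1), sum_range_succ (fun j => f (2 * j + 1)) m,
        show 2 * (m + 1) = 2 * m + 1 + 1 by omega]
      abel

theorem majB_inflate {n : ℕ} (β : Bgrp n) (c : Fin n → Bool) :
    majB (inflate β c) = 2 * majB β + ∑ j, if c j then 2 * (j : ℕ) + 1 else 0 := by
  rw [majB_eq_sum, majB_eq_sum, sum_range_two_mul_sub_one, add_comm, mul_sum]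
  congr 1
  · refine sum_congr rfl fun j hj => ?_
    rw [mem_range] at hj
    have hj0 : j < n := by omega
    have hj1 : j + 1 < n := by omega
    have w1 := wdwN_inflate β c hj0 true
    have w0 := wdwN_inflate β c hj1 false
    rw [Bool.toNat_true] at w1
    rw [Bool.toNat_false, add_zero, show 2 * (j + 1) = 2 * j + 1 + 1 by ring] at w0
    have hne : (β.1 ⟨j, hj0⟩ : ℕ) ≠ β.1 ⟨j + 1, hj1⟩ := by
      simp [← Fin.ext_iff]
    have key : precLt (wdwN (inflate β c) (2 * j + 1 + 1)) (wdwN (inflate β c) (2 * j + 1)) ↔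
        precLt (wdwN β (j + 1)) (wdwN β j) := by
      rw [w1, w0, wdwN_eq _ hj0, wdwN_eq _ hj1]
      have t1 := (true ^^ c ⟨j, hj0⟩).toNat_le
      have t0 := (false ^^ c ⟨j + 1, hj1⟩).toNat_le
      unfold precLt
      split_ifs <;> omega
    simp only [key, mul_ite, mul_zero, mul_add, mul_one]
  · rw [sum_range]
    refine sum_congr rfl fun j _ => ?_
    have w0 := wdwN_inflate β c j.2 false
    have w1 := wdwN_inflate β c j.2 true
    rw [Bool.toNat_true] at w1
    rw [Bool.toNat_false, add_zero] at w0
    have key : precLt (wdwN (inflate β c) (2 * j + 1)) (wdwN (inflate β c) (2 * j)) ↔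
        c j = true := by
      rw [w1, w0]
      unfold precLt
      cases c j <;> split_ifs <;> simp <;> omega
    simp only [key]

theorem fmaj_inflate {n : ℕ} (β : Bgrp n) (c : Fin n → Bool) :
    fmaj (inflate β c) = 2 * fmaj β + ∑ j, if c j then 4 * ((j : ℕ) + 1) - 2 else 0 := by
  have h : ∑ j : Fin n, (if c j then 4 * ((j : ℕ) + 1) - 2 else 0) =
      2 * ∑ j : Fin n, if c j then 2 * (j : ℕ) + 1 else 0 := by
    rw [mul_sum]
    refine sum_congr rfl fun j _ => ?_
    split_ifs <;> omega
  rw [fmaj, fmaj, majB_inflate, N1_inflate, h]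
  ring

theorem paired_inflate {n : ℕ} (β : Bgrp n) (c : Fin n → Bool) (i : Fin n) :
    Paired (inflate β c) i := by
  obtain ⟨j, rfl⟩ := β.1.surjective i
  refine ⟨blockEquiv n (j, false), blockEquiv n (j, true), rfl, ?_, ?_, ?_⟩
  · rw [inflate_fst, blockEquiv_val]
    have := (false ^^ c j).toNat_le
    dsimp only
    omega
  · rw [inflate_fst, blockEquiv_val]
    have := (true ^^ c j).toNat_le
    dsimp only
    omega
  · rw [inflate_snd, inflate_snd]

theorem inflate_injective {n : ℕ} :
    Function.Injective fun x : Bgrp n × (Fin n → Bool) => inflate x.1 x.2 := by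
  rintro ⟨β, c⟩ ⟨γ, d⟩ h
  have h1 (j : Fin n) : β.1 j = γ.1 j ∧ c j = d j := by
    have := congrArg (fun x : Bgrp (2 * n) => x.1 (blockEquiv n (j, false))) h
    simpa [inflate_fst] using this
  have h2 (j : Fin n) : β.2 j = γ.2 j := by
    have := congrArg (fun x : Bgrp (2 * n) => x.2 (blockEquiv n (j, false))) h
    simpa [inflate_snd] using this
  exact Prod.ext (Prod.ext (Equiv.ext fun j => (h1 j).1) (funext h2)) (funext fun j => (h1 j).2)

/-- If all pairs of absolute values are adjacent, then they occupy the blocks of `blockEquiv`. -/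
theorem block_of_paired {n : ℕ} {β : Bgrp (2 * n)} (h : ∀ i, Paired β i) {j : ℕ} (hj : j < n) :
    (β.1 (blockEquiv n (⟨j, hj⟩, true)) : ℕ) / 2 = (β.1 (blockEquiv n (⟨j, hj⟩, false)) : ℕ) / 2 ∧
      β.2 (blockEquiv n (⟨j, hj⟩, true)) = β.2 (blockEquiv n (⟨j, hj⟩, false)) := by
  have inj (k l : Fin (2 * n)) (hkl : (β.1 k : ℕ) = β.1 l) : (k : ℕ) = l :=
    congrArg Fin.val (β.1.injective (Fin.ext hkl))
  induction j with
  | zero =>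
    obtain ⟨k, l, hl, hk2, hl2, hs⟩ :=
      h ⟨(β.1 (blockEquiv n (⟨0, hj⟩, false)) : ℕ) / 2, by omega⟩
    have v0 : (blockEquiv n (⟨0, hj⟩, false) : ℕ) = 0 := rfl
    have i1 := inj k (blockEquiv n (⟨0, hj⟩, false))
    have i2 := inj l (blockEquiv n (⟨0, hj⟩, false))
    have i3 := inj k l
    simp only at hk2 hl2
    have ek : k = blockEquiv n (⟨0, hj⟩, false) := Fin.ext (by omega)
    have el : l = blockEquiv n (⟨0, hj⟩, true) := Fin.ext (by rw [hl, ek]; rfl)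
    subst ek el
    exact ⟨hl2, hs.symm⟩
  | succ j ih =>
    have hj' : j < n := by omega
    obtain ⟨ih, -⟩ := ih hj'
    obtain ⟨k, l, hl, hk2, hl2, hs⟩ :=
      h ⟨(β.1 (blockEquiv n (⟨j + 1, hj⟩, false)) : ℕ) / 2, by omega⟩
    have v0 : (blockEquiv n (⟨j + 1, hj⟩, false) : ℕ) = 2 * (j + 1) := rfl
    have v1 : (blockEquiv n (⟨j, hj'⟩, false) : ℕ) = 2 * j := rfl
    have v2 : (blockEquiv n (⟨j, hj'⟩, true) : ℕ) = 2 * j + 1 := rfl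
    have i1 := inj k (blockEquiv n (⟨j + 1, hj⟩, false))
    have i2 := inj l (blockEquiv n (⟨j + 1, hj⟩, false))
    have i3 := inj k l
    have i4 := inj (blockEquiv n (⟨j, hj'⟩, false)) (blockEquiv n (⟨j + 1, hj⟩, false))
    have i5 := inj (blockEquiv n (⟨j, hj'⟩, true)) (blockEquiv n (⟨j + 1, hj⟩, false))
    have i6 := inj (blockEquiv n (⟨j, hj'⟩, true)) (blockEquiv n (⟨j, hj'⟩, false))
    have i7 := inj k (blockEquiv n (⟨j, hj'⟩, false))
    simp only at hk2 hl2
    have ek : k = blockEquiv n (⟨j + 1, hj⟩, false) := by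
      refine Fin.ext ?_
      by_contra hne
      have hkv : k = blockEquiv n (⟨j, hj'⟩, true) := Fin.ext (by omega)
      rw [hkv] at hk2
      omega
    have el : l = blockEquiv n (⟨j + 1, hj⟩, true) := Fin.ext (by rw [hl, ek]; rfl)
    subst ek el
    exact ⟨hl2, hs.symm⟩

theorem exists_inflate_eq {n : ℕ} {β : Bgrp (2 * n)} (h : ∀ i, Paired β i) :
    ∃ x : Bgrp n × (Fin n → Bool), inflate x.1 x.2 = β := by
  have inj (k l : Fin n × Bool) (hkl : (β.1 (blockEquiv n k) : ℕ) = β.1 (blockEquiv n l)) :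
      k = l :=
    (blockEquiv n).injective (β.1.injective (Fin.ext hkl))
  let f : Fin n → Fin n := fun j => ⟨(β.1 (blockEquiv n (j, false)) : ℕ) / 2, by omega⟩
  have hf : Function.Injective f := by
    intro j k hjk
    have e : (β.1 (blockEquiv n (j, false)) : ℕ) / 2 = (β.1 (blockEquiv n (k, false)) : ℕ) / 2 :=
      congrArg Fin.val hjk
    have ej := (block_of_paired h j.2).1
    by_contra hne
    have h1 : (β.1 (blockEquiv n (j, false)) : ℕ) ≠ β.1 (blockEquiv n (k, false)) :=
      fun h => hne (by simpa using inj _ _ h)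
    have h2 : (β.1 (blockEquiv n (j, true)) : ℕ) ≠ β.1 (blockEquiv n (k, false)) :=
      fun h => by simpa using inj _ _ h
    have h3 : (β.1 (blockEquiv n (j, true)) : ℕ) ≠ β.1 (blockEquiv n (j, false)) :=
      fun h => by simpa using inj _ _ h
    simp only [Fin.eta] at ej
    omega
  refine ⟨((Equiv.ofBijective f (Finite.injective_iff_bijective.1 hf),
    fun j => β.2 (blockEquiv n (j, false))),
    fun j => decide ((β.1 (blockEquiv n (j, false)) : ℕ) % 2 = 1)), ?_⟩
  refine Prod.ext (Equiv.ext fun k => ?_) (funext fun k => ?_) <;>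
    obtain ⟨⟨j, b⟩, rfl⟩ := (blockEquiv n).surjective k
  · have ej := (block_of_paired h j.2).1
    have h3 : (β.1 (blockEquiv n (j, true)) : ℕ) ≠ β.1 (blockEquiv n (j, false)) :=
      fun h => by simpa using inj _ _ h
    simp only [Fin.eta] at ej
    rw [inflate_fst]
    refine Fin.ext ?_
    rw [blockEquiv_val]
    change 2 * ((β.1 (blockEquiv n (j, false)) : ℕ) / 2) + _ = _
    rcases Nat.mod_two_eq_zero_or_one (β.1 (blockEquiv n (j, false))) with hm | hm <;>
      cases b <;> simp [hm] <;> omega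
  · rw [inflate_snd]
    cases b
    · rfl
    · exact (block_of_paired h j.2).2.symm

theorem sum_paired {n : ℕ} {R : Type*} [CommRing R] (q : R) :
    ∑ β : Bgrp (2 * n) with ¬ (unpaired β).Nonempty, (signB β : R) * q ^ fmaj β =
      ∑ x : Bgrp n × (Fin n → Bool), (signB (inflate x.1 x.2) : R) * q ^ fmaj (inflate x.1 x.2) := by
  have hu {β : Bgrp (2 * n)} : ¬ (unpaired β).Nonempty ↔ ∀ i, Paired β i := by
    simp [Finset.Nonempty, mem_unpaired]
  symm
  refine sum_nbij (fun x => inflate x.1 x.2) ?_ inflate_injective.injOn ?_ ?_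
  · intro x _
    rw [mem_filter, hu]
    exact ⟨mem_univ _, paired_inflate _ _⟩
  · intro β hβ
    rw [mem_coe, mem_filter, hu] at hβ
    obtain ⟨x, hx⟩ := exists_inflate_eq hβ.2
    exact ⟨x, mem_coe.2 (mem_univ x), hx⟩
  · intro x _
    rfl

theorem sum_inflate {n : ℕ} {R : Type*} [CommRing R] (q : R) (β : Bgrp n) :
    ∑ c : Fin n → Bool, (signB (inflate β c) : R) * q ^ fmaj (inflate β c) =
      (∏ i ∈ range n, (1 - q ^ (4 * (i + 1) - 2))) * q ^ (2 * fmaj β) := by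
  have h : ∏ i ∈ range n, (1 - q ^ (4 * (i + 1) - 2)) =
      ∑ c : Fin n → Bool, ∏ j, if c j then -q ^ (4 * ((j : ℕ) + 1) - 2) else 1 := by
    rw [prod_range, ← Fintype.piFinset_univ, ← prod_univ_sum (fun _ => (univ : Finset Bool))
      (fun (j : Fin n) b => if b then -q ^ (4 * ((j : ℕ) + 1) - 2) else 1)]
    refine prod_congr rfl fun j _ => ?_
    rw [Fintype.sum_bool]
    simp only [if_true, Bool.false_eq_true, if_false]
    ring
  rw [h, sum_mul]
  refine sum_congr rfl fun c _ => ?_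
  rw [signB_inflate, fmaj_inflate, pow_add, ← prod_pow_eq_pow_sum, mul_left_comm, mul_comm,
    Int.cast_prod, ← prod_mul_distrib]
  congr 1
  refine prod_congr rfl fun j _ => ?_
  split_ifs <;> simp

/-- `∑_{β ∈ B_{2n}} (-1)^{ℓ_B β} q^{fmaj β} = ∏_{i=1}^n (1-q^{4i-2}) ∑_{β ∈ B_n} q^{2 fmaj β}`. -/
theorem stmt14 (n : ℕ) (hn : 0 < n) :
    ∑ β : Bgrp (2*n), (-1 : Polynomial ℤ) ^ lenB β * X ^ fmaj β =
      (∏ i ∈ range n, (1 - (X : Polynomial ℤ) ^ (4*(i+1) - 2))) *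
        ∑ β : Bgrp n, (X : Polynomial ℤ) ^ (2 * fmaj β) := by
  have h (β : Bgrp (2 * n)) : (-1 : Polynomial ℤ) ^ lenB β = (signB β : Polynomial ℤ) := by
    rw [← neg_one_pow_lenB]
    push_cast
    rfl
  simp only [h]
  rw [← sum_filter_add_sum_filter_not univ fun β => (unpaired β).Nonempty, sum_unpaired_eq_zero,
    zero_add, sum_paired, Fintype.sum_prod_type, mul_sum]
  exact sum_congr rfl fun β _ => sum_inflate X β
end
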